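/- arXiv:math/0511607 — 2 statements merged into one kernel-verified Lean document; each statement's English description precedes it below -/
import Mathlib

section
/- Let A be a nontrivial monotone subset of {0,1}^n, let g be a continuous positive function on [0,1], and let a be a positive real number. Then the following are equivalent: (i) for all p ∈ [0,1], dμ_p(A)/dp ≥ (a/g(p)) · μ_p(A)(1 − μ_p(A)); (ii) for all α ≤ β in (0,1), p(β) − p(α) ≤ (1/a) · sup_{r ∈ [p(α), p(β)]} { g(r) } · log( β(1−α) / (α(1−β)) ). -/
open Finset

/-- Weight of a point `x ∈ {0,1}^n` under the product Bernoulli(p) measure: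
`p^{∑ xᵢ} (1-p)^{∑ (1-xᵢ)}`. -/
noncomputable def muW (n : ℕ) (p : ℝ) (x : Fin n → Bool) : ℝ :=
  ∏ i : Fin n, if x i then p else 1 - p

/-- The measure `μ_{n,p}(A)` of a subset `A ⊆ {0,1}^n`. -/
noncomputable def muP (n : ℕ) (p : ℝ) (A : Finset (Fin n → Bool)) : ℝ :=
  ∑ x ∈ A, muW n p x

/-- Expectation `∫ f dμ_{n,p}` of a real function on `{0,1}^n`. -/
noncomputable def muE (n : ℕ) (p : ℝ) (f : (Fin n → Bool) → ℝ) : ℝ :=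
  ∑ x : Fin n → Bool, muW n p x * f x

/-- `A` is monotone: `x ∈ A` and `x ≤ y` coordinatewise imply `y ∈ A`. -/
def MonotoneSet (n : ℕ) (A : Finset (Fin n → Bool)) : Prop :=
  ∀ x ∈ A, ∀ y : Fin n → Bool, (∀ i, x i ≤ y i) → y ∈ A

/-- `A` is symmetric: invariant under a transitive subgroup of permutations of coordinates. -/
def SymmetricSet (n : ℕ) (A : Finset (Fin n → Bool)) : Prop :=
  ∃ G : Subgroup (Equiv.Perm (Fin n)),
    (∀ i j : Fin n, ∃ g ∈ G, g i = j) ∧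
    (∀ g ∈ G, ∀ x ∈ A, (fun i => x (g⁻¹ i)) ∈ A)

/-- Discrete gradient `∇_i f`. -/
noncomputable def grad (n : ℕ) (i : Fin n) (f : (Fin n → Bool) → ℝ)
    (x : Fin n → Bool) : ℝ :=
  f (Function.update x i true) - f (Function.update x i false)

/-- The operator `Δ_i f = f - ∫ f dμ_{1,p}(x_i)`. -/
noncomputable def del (n : ℕ) (p : ℝ) (i : Fin n) (f : (Fin n → Bool) → ℝ)
    (x : Fin n → Bool) : ℝ :=
  f x - (p * f (Function.update x i true) + (1 - p) * f (Function.update x i false))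

open Classical in
/-- Influence of coordinate `i` on a function `f`: the `μ_{n,p}`-probability
that `f` is not constant on the `i`-th fiber. -/
noncomputable def infl (n : ℕ) (p : ℝ) (i : Fin n) (f : (Fin n → Bool) → ℝ) : ℝ :=
  muP n p (Finset.univ.filter fun x =>
    f (Function.update x i true) ≠ f (Function.update x i false))

open Classical in
/-- Influence of coordinate `i` on a set `A`. -/
noncomputable def inflSet (n : ℕ) (p : ℝ) (i : Fin n) (A : Finset (Fin n → Bool)) : ℝ :=
  muP n p (Finset.univ.filter fun x =>
    ¬((Function.update x i true ∈ A) ↔ (Function.update x i false ∈ A)))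

/-- Entropy of a (nonnegative) function with respect to `μ_{n,p}`. -/
noncomputable def ent (n : ℕ) (p : ℝ) (g : (Fin n → Bool) → ℝ) : ℝ :=
  muE n p (fun x => g x * Real.log (g x)) - muE n p g * Real.log (muE n p g)

/-- Variance of a function with respect to `μ_{n,p}`. -/
noncomputable def varE (n : ℕ) (p : ℝ) (f : (Fin n → Bool) → ℝ) : ℝ :=
  muE n p (fun x => f x ^ 2) - (muE n p f) ^ 2

/-- Conditional expectation `E[f | x_1, …, x_j]` under `μ_{n,p}`:
average over the last `n - j` coordinates. -/
noncomputable def condE (n : ℕ) (p : ℝ) (j : ℕ) (f : (Fin n → Bool) → ℝ)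
    (x : Fin n → Bool) : ℝ :=
  ∑ y : Fin n → Bool,
    (∏ i : Fin n, if (i : ℕ) < j then (if y i = x i then (1 : ℝ) else 0)
      else (if y i then p else 1 - p)) * f y

/-- The logarithmic Sobolev constant of the two-point Bernoulli(p) space. -/
noncomputable def cLS (p : ℝ) : ℝ :=
  if p = 1 / 2 then 2 else (Real.log (1 - p) - Real.log p) / (1 - 2 * p)

/-- The sequence `s(n)` of Theorem 4.1. -/
noncomputable def sseq (n : ℕ) : ℝ :=
  Real.log n -
    max (Real.log ((Real.exp 1 ^ (2 + 4 / Real.exp 1) / (2 : ℝ) ^ (5 + 4 / Real.exp 1)) *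
        Real.log ((n : ℝ) / Real.log n ^ 2) ^ (3 + 4 / Real.exp 1)))
      (2 * Real.log (Real.log n))

theorem muW_pos' (n : ℕ) (p : ℝ) (hp : p ∈ Set.Ioo (0:ℝ) 1) (x : Fin n → Bool) :
    0 < muW n p x := by
  unfold muW
  refine Finset.prod_pos fun i _ => ?_
  split_ifs
  · exact hp.1
  · linarith [hp.2]

theorem muW_sum' (n : ℕ) (p : ℝ) : ∑ x : Fin n → Bool, muW n p x = 1 := by
  unfold muW
  have h := Finset.prod_univ_sum (fun _ : Fin n => (Finset.univ : Finset Bool))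
    (fun _ b => if b then p else 1 - p)
  simp only [Fintype.piFinset_univ] at h
  rw [← h]
  simp

theorem muP_pos' (n : ℕ) (A : Finset (Fin n → Bool)) (hne : A.Nonempty)
    (p : ℝ) (hp : p ∈ Set.Ioo (0:ℝ) 1) : 0 < muP n p A :=
  Finset.sum_pos (fun x _ => muW_pos' n p hp x) hne

theorem muP_lt_one' (n : ℕ) (A : Finset (Fin n → Bool)) (hnu : A ≠ Finset.univ)
    (p : ℝ) (hp : p ∈ Set.Ioo (0:ℝ) 1) : muP n p A < 1 := by
  have h1 : muP n p A + muP n p Aᶜ = 1 := by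
    rw [← muW_sum' n p]
    exact Finset.sum_add_sum_compl A _
  have h2 : 0 < muP n p Aᶜ := by
    apply muP_pos' n _ _ p hp
    rw [Finset.nonempty_iff_ne_empty]
    simpa using hnu
  linarith

theorem muP_mono' (n : ℕ) (A : Finset (Fin n → Bool)) (hmono : MonotoneSet n A)
    (p q : ℝ) (hp : p ∈ Set.Ioo (0:ℝ) 1) (hq : q ∈ Set.Ioo (0:ℝ) 1) (hpq : p ≤ q) :
    muP n p A ≤ muP n q A := by
  classical
  have h := holley (α := Fin n → Bool) (β := ℝ) (μ := fun x => if x ∈ A then (1:ℝ) else 0)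
    (f := muW n p) (g := muW n q)
    (by intro x; dsimp; split_ifs <;> norm_num)
    (fun x => (muW_pos' n p hp x).le) (fun x => (muW_pos' n q hq x).le)
    (by
      intro x y hxy
      dsimp
      by_cases hx : x ∈ A
      · have : y ∈ A := hmono x hx y hxy
        simp [hx, this]
      · simp only [hx, if_false]; split_ifs <;> norm_num)
    (by rw [muW_sum', muW_sum'])
    (by
      intro x y
      unfold muW
      rw [← Finset.prod_mul_distrib, ← Finset.prod_mul_distrib]
      obtain ⟨hp0, hp1⟩ := hp
      obtain ⟨hq0, hq1⟩ := hq
      refine Finset.prod_le_prod (fun i _ => ?_) (fun i _ => ?_)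
      · apply mul_nonneg <;> split_ifs <;> linarith
      · rw [Pi.inf_apply, Pi.sup_apply]
        cases x i <;> cases y i <;> simp <;> nlinarith)
  simpa [muP, Finset.sum_ite_mem] using h

theorem muP_contDiff' (n : ℕ) (A : Finset (Fin n → Bool)) :
    ContDiff ℝ 1 (fun q => muP n q A) := by
  unfold muP muW
  refine ContDiff.sum fun x _ => contDiff_prod fun i _ => ?_
  split_ifs
  · exact contDiff_id
  · exact contDiff_const.sub contDiff_id

theorem logit_deriv' (n : ℕ) (A : Finset (Fin n → Bool)) (hne : A.Nonempty)
    (hnu : A ≠ Finset.univ) (p : ℝ) (hp : p ∈ Set.Ioo (0:ℝ) 1) :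
    HasDerivAt (fun q => Real.log (muP n q A) - Real.log (1 - muP n q A))
      (deriv (fun q => muP n q A) p / (muP n p A * (1 - muP n p A))) p := by
  have h0 := muP_pos' n A hne p hp
  have h1 : 0 < 1 - muP n p A := by linarith [muP_lt_one' n A hnu p hp]
  have hd : HasDerivAt (fun q => muP n q A) (deriv (fun q => muP n q A) p) p :=
    ((muP_contDiff' n A).differentiable (by norm_num) p).hasDerivAt
  have := (hd.log h0.ne').sub ((hd.const_sub 1).log h1.ne')
  refine HasDerivAt.congr_deriv this ?_
  field_simp
  ring

theorem log_eq' (α β : ℝ) (h0 : 0 < α) (h1 : α < 1) (h2 : 0 < β) (h3 : β < 1) :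
    Real.log (β * (1 - α) / (α * (1 - β))) =
      (Real.log β - Real.log (1 - β)) - (Real.log α - Real.log (1 - α)) := by
  have h1' : 0 < 1 - α := by linarith
  have h3' : 0 < 1 - β := by linarith
  rw [Real.log_div (by positivity) (by positivity), Real.log_mul h2.ne' h1'.ne',
    Real.log_mul h0.ne' h3'.ne']
  ring

/-- Lemma 2.1: for nontrivial monotone `A`, continuous positive `g` on `[0,1]`
and `a > 0`, the pointwise derivative lower bound (i) is equivalent to the threshold-gap
upper bound (ii). -/
theorem stmt4 (n : ℕ) (hn : 0 < n) (A : Finset (Fin n → Bool))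
    (hmono : MonotoneSet n A) (hne : A.Nonempty) (hnu : A ≠ Finset.univ)
    (g : ℝ → ℝ) (hgc : ContinuousOn g (Set.Icc (0 : ℝ) 1))
    (hgpos : ∀ p ∈ Set.Icc (0 : ℝ) 1, 0 < g p)
    (a : ℝ) (ha : 0 < a) :
    (∀ p ∈ Set.Icc (0 : ℝ) 1,
        deriv (fun q => muP n q A) p ≥ a / g p * (muP n p A * (1 - muP n p A))) ↔
    (∀ α β : ℝ, 0 < α → α ≤ β → β < 1 → ∀ pa pb : ℝ,
        pa ∈ Set.Ioo (0 : ℝ) 1 → muP n pa A = α →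
        pb ∈ Set.Ioo (0 : ℝ) 1 → muP n pb A = β →
        pb - pa ≤ 1 / a * sSup (g '' Set.Icc pa pb) *
          Real.log (β * (1 - α) / (α * (1 - β)))) := by
  set L : ℝ → ℝ := fun q => Real.log (muP n q A) - Real.log (1 - muP n q A) with hL
  have hpos := muP_pos' n A hne
  have hlt := muP_lt_one' n A hnu
  have hLd := logit_deriv' n A hne hnu
  constructor
  · intro H α β hα hαβ hβ pa pb hpa hA hpb hB
    rcases lt_or_ge pb pa with hlt' | hle
    · rw [Set.Icc_eq_empty (by linarith)]
      simp
      exact hlt'.le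
    · have hsub : Set.Icc pa pb ⊆ Set.Ioo (0:ℝ) 1 := fun x hx =>
        ⟨lt_of_lt_of_le hpa.1 hx.1, lt_of_le_of_lt hx.2 hpb.2⟩
      have hbdd : BddAbove (g '' Set.Icc pa pb) :=
        (isCompact_Icc.image_of_continuousOn
          (hgc.mono (hsub.trans Set.Ioo_subset_Icc_self))).bddAbove
      set S := sSup (g '' Set.Icc pa pb) with hS
      have hgS : ∀ x ∈ Set.Icc pa pb, g x ≤ S := fun x hx => le_csSup hbdd ⟨x, hx, rfl⟩
      have hSpos : 0 < S := lt_of_lt_of_le (hgpos pa ⟨hpa.1.le, hpa.2.le⟩)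
        (hgS pa ⟨le_rfl, hle⟩)
      have key : a / S * (pb - pa) ≤ L pb - L pa := by
        refine Convex.mul_sub_le_image_sub_of_le_deriv (convex_Icc pa pb)
          (fun x hx => (hLd x (hsub hx)).continuousAt.continuousWithinAt)
          (fun x hx => (hLd x (hsub (interior_subset hx))).differentiableAt.differentiableWithinAt)
          ?_ pa ⟨le_rfl, hle⟩ pb ⟨hle, le_rfl⟩ hle
        intro x hx
        have hx := interior_subset hx
        have hx' := hsub hx
        rw [(hLd x hx').deriv]
        have h0 := hpos x hx'
        have h1 : 0 < 1 - muP n x A := by linarith [hlt x hx']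
        rw [le_div_iff₀ (by positivity)]
        refine le_trans ?_ (H x ⟨hx'.1.le, hx'.2.le⟩)
        have hg := hgpos x ⟨hx'.1.le, hx'.2.le⟩
        have hgs := hgS x hx
        gcongr
      rw [log_eq' α β hα (by linarith) (by linarith) hβ, ← hA, ← hB]
      change _ ≤ 1 / a * S * (L pb - L pa)
      calc pb - pa = 1 / a * S * (a / S * (pb - pa)) := by field_simp
        _ ≤ _ := by gcongr
  · intro H
    have hcd := muP_contDiff' n A
    have hint : ∀ p ∈ Set.Ioo (0:ℝ) 1,
        a / g p * (muP n p A * (1 - muP n p A)) ≤ deriv (fun q => muP n q A) p := by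
      intro p hp
      have hp' : p ∈ Set.Icc (0:ℝ) 1 := ⟨hp.1.le, hp.2.le⟩
      have h0 := hpos p hp
      have h1 : 0 < 1 - muP n p A := by linarith [hlt p hp]
      have hgp := hgpos p hp'
      rw [← le_div_iff₀ (by positivity)]
      set D := deriv (fun q => muP n q A) p / (muP n p A * (1 - muP n p A)) with hD
      have hcont : ContinuousAt g p := hgc.continuousAt (Icc_mem_nhds hp.1 hp.2)
      have heps : ∀ ε > 0, a / (g p + ε) ≤ D := by
        intro ε hε
        have hev : ∀ᶠ x in nhds p, g x < g p + ε :=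
          hcont.eventually (gt_mem_nhds (by linarith))
        obtain ⟨δ, hδ, hball⟩ := Metric.eventually_nhds_iff.1 hev
        have hslope := ((hasDerivAt_iff_tendsto_slope.1 (hLd p hp)).mono_left
          (nhdsWithin_mono p (show Set.Ioi p ⊆ {p}ᶜ from fun x hx => ne_of_gt hx)))
        refine ge_of_tendsto hslope ?_
        have hmem : Set.Ioo p (min 1 (p + δ)) ∈ nhdsWithin p (Set.Ioi p) :=
          Ioo_mem_nhdsGT (lt_min hp.2 (by linarith))
        filter_upwards [hmem] with q hq
        have hq1 : q < 1 := lt_of_lt_of_le hq.2 (min_le_left _ _)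
        have hqd : q < p + δ := lt_of_lt_of_le hq.2 (min_le_right _ _)
        have hpq : p < q := hq.1
        have hq' : q ∈ Set.Ioo (0:ℝ) 1 := ⟨hp.1.trans hpq, hq1⟩
        have hm := muP_mono' n A hmono p q hp hq' hpq.le
        have hh := H _ _ h0 hm (hlt q hq') p q hp rfl hq' rfl
        rw [log_eq' _ _ h0 (hlt p hp) (hpos q hq') (hlt q hq')] at hh
        change _ ≤ 1 / a * _ * (L q - L p) at hh
        have hS : sSup (g '' Set.Icc p q) ≤ g p + ε := by
          refine csSup_le ⟨g p, p, ⟨le_rfl, hpq.le⟩, rfl⟩ ?_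
          rintro _ ⟨x, hx, rfl⟩
          refine (hball ?_).le
          rw [Real.dist_eq, abs_of_nonneg (by linarith [hx.1])]
          linarith [hx.2]
        have hLm : 0 ≤ L q - L p := by
          have e1 := Real.log_le_log h0 hm
          have e2 := Real.log_le_log (show 0 < 1 - muP n q A by linarith [hlt q hq'])
            (show 1 - muP n q A ≤ 1 - muP n p A by linarith)
          simp only [hL]
          linarith
        have hh2 : q - p ≤ 1 / a * (g p + ε) * (L q - L p) := hh.trans (by gcongr)
        rw [slope_def_field, le_div_iff₀ (by linarith), div_mul_eq_mul_div,
          div_le_iff₀ (by linarith)]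
        have h3 : a * (q - p) ≤ a * (1 / a * (g p + ε) * (L q - L p)) := by gcongr
        have h4 : a * (1 / a * (g p + ε) * (L q - L p)) = (L q - L p) * (g p + ε) := by
          field_simp
        change a * (q - p) ≤ (L q - L p) * (g p + ε)
        linarith
      have ht : Filter.Tendsto (fun ε : ℝ => a / (g p + ε)) (nhdsWithin 0 (Set.Ioi 0))
          (nhds (a / (g p + 0))) := by
        refine Filter.Tendsto.mono_left ?_ nhdsWithin_le_nhds
        exact tendsto_const_nhds.div (tendsto_const_nhds.add Filter.tendsto_id)
          (by simpa using hgp.ne')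
      rw [add_zero] at ht
      exact le_of_tendsto ht (by filter_upwards [self_mem_nhdsWithin] with ε hε using heps ε hε)
    have hcl : closure (Set.Ioo (0:ℝ) 1) = Set.Icc 0 1 := closure_Ioo (by norm_num)
    intro p hp
    rw [← hcl] at hp
    refine le_on_closure (f := fun p => a / g p * (muP n p A * (1 - muP n p A))) hint ?_ ?_ hp
    · rw [hcl]
      exact (continuousOn_const.div hgc (fun x hx => (hgpos x hx).ne')).mul
        (hcd.continuous.mul (continuous_const.sub hcd.continuous)).continuousOn
    · exact (hcd.continuous_deriv (by norm_num)).continuousOn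
end

section
/- (Logarithmic Sobolev inequality on the hypercube) For every positive integer n, every p ∈ (0,1), and every real function f on {0,1}^n: Ent_{μ_{n,p}}(f²) ≤ c_LS(p) · ∑_{i=1}^n ∫ (Δ_i f)² dμ_{n,p}. -/
open Finset

open Real in
theorem aux_F_deriv (k u : ℝ) :
    HasDerivAt (fun u => log (cosh u) - u * (sinh u / cosh u) - k / cosh u)
      ((k * sinh u - u) / cosh u ^ 2) u := by
  have hc : cosh u ≠ 0 := (cosh_pos u).ne'
  have h1 := (hasDerivAt_cosh u).log hc
  have h2 := (hasDerivAt_id u).mul ((hasDerivAt_sinh u).div (hasDerivAt_cosh u) hc)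
  have h3 := (hasDerivAt_const u k).div (hasDerivAt_cosh u) hc
  have h := (h1.sub h2).sub h3
  refine h.congr_deriv ?_
  simp only [id, Pi.div_apply]
  have := cosh_sq u
  field_simp
  rw [this]; ring

open Real in
theorem aux_convex : ConvexOn ℝ (Set.Ici (0 : ℝ)) sinh := by
  apply MonotoneOn.convexOn_of_deriv (convex_Ici 0) continuous_sinh.continuousOn
    differentiable_sinh.differentiableOn
  rw [interior_Ici, Real.deriv_sinh]
  intro x hx y hy hxy
  have hx' : 0 < x := hx
  have hy' : 0 < y := hy
  exact cosh_le_cosh.2 (by rwa [abs_of_pos hx', abs_of_pos hy'])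

open Real in
theorem aux_ratio {x y : ℝ} (hx : 0 ≤ x) (hxy : x ≤ y) : y * sinh x ≤ x * sinh y := by
  rcases hx.eq_or_lt with rfl | hx
  · simp
  have hy : 0 < y := hx.trans_le hxy
  have h := aux_convex.2 (Set.mem_Ici.2 le_rfl) (Set.mem_Ici.2 hy.le)
    (show 0 ≤ 1 - x / y by rw [sub_nonneg, div_le_one hy]; exact hxy)
    (show 0 ≤ x / y by positivity) (by ring)
  simp only [smul_eq_mul, mul_zero, zero_add, sinh_zero] at h
  rw [div_mul_cancel₀ _ hy.ne'] at h
  calc y * sinh x ≤ y * (x / y * sinh y) := by gcongr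
    _ = x * sinh y := by field_simp

open Real in
theorem aux_F_min {k v u : ℝ} (hv : 0 ≤ v) (hu : 0 ≤ u)
    (h1 : ∀ x, 0 ≤ x → x ≤ v → k * sinh x ≤ x) (h2 : ∀ x, v ≤ x → x ≤ k * sinh x) :
    log (cosh v) - v * (sinh v / cosh v) - k / cosh v ≤
      log (cosh u) - u * (sinh u / cosh u) - k / cosh u := by
  have hcont : Continuous (fun u => log (cosh u) - u * (sinh u / cosh u) - k / cosh u) :=
    continuous_iff_continuousAt.2 fun x => (aux_F_deriv k x).continuousAt
  rcases le_total u v with h | h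
  · have := antitoneOn_of_deriv_nonpos (convex_Icc 0 v) hcont.continuousOn
      (fun x _ => (aux_F_deriv k x).differentiableAt.differentiableWithinAt) (by
        intro x hx
        rw [interior_Icc] at hx
        rw [(aux_F_deriv k x).deriv]
        have := h1 x hx.1.le hx.2.le
        exact div_nonpos_of_nonpos_of_nonneg (by linarith) (by positivity))
    exact this ⟨hu, h⟩ ⟨hv, le_rfl⟩ h
  · have := monotoneOn_of_deriv_nonneg (convex_Ici v) hcont.continuousOn
      (fun x _ => (aux_F_deriv k x).differentiableAt.differentiableWithinAt) (by
        intro x hx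
        rw [interior_Ici] at hx
        rw [(aux_F_deriv k x).deriv]
        have := h2 x (le_of_lt hx)
        exact div_nonneg (by linarith) (by positivity))
    exact this (Set.mem_Ici.2 le_rfl) h h

open Real in
theorem aux_F_even (k u : ℝ) :
    log (cosh |u|) - |u| * (sinh |u| / cosh |u|) - k / cosh |u| =
      log (cosh u) - u * (sinh u / cosh u) - k / cosh u := by
  rcases abs_choice u with h | h <;> rw [h]
  simp [neg_div]

open Real in
theorem aux_F (k v u : ℝ) (hk : k = if v = 0 then 1 else v / sinh v) :
    log (cosh v) - v * (sinh v / cosh v) - k / cosh v ≤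
      log (cosh u) - u * (sinh u / cosh u) - k / cosh u := by
  rw [← aux_F_even k v, ← aux_F_even k u]
  have hk' : k = if |v| = 0 then 1 else |v| / sinh |v| := by
    rw [hk]
    rcases abs_choice v with h | h <;> rw [h]
    simp
  apply aux_F_min (abs_nonneg _) (abs_nonneg _)
  · intro x hx hxv
    rcases eq_or_ne (|v|) 0 with h | h
    · have : x = 0 := by linarith
      simp [this]
    · rw [hk', if_neg h]
      have : 0 < sinh |v| := sinh_pos_iff.2 (lt_of_le_of_ne (abs_nonneg v) (Ne.symm h))
      rw [div_mul_eq_mul_div, div_le_iff₀ this]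
      exact aux_ratio hx hxv
  · intro x hx
    rcases eq_or_ne (|v|) 0 with h | h
    · rw [hk', if_pos h, one_mul]
      exact self_le_sinh_iff.2 (by linarith)
    · rw [hk', if_neg h]
      have : 0 < sinh |v| := sinh_pos_iff.2 (lt_of_le_of_ne (abs_nonneg v) (Ne.symm h))
      rw [div_mul_eq_mul_div, le_div_iff₀ this]
      exact aux_ratio (abs_nonneg v) hx

open Real in
theorem aux_core (k v u : ℝ) (hk : k = if v = 0 then 1 else v / sinh v) :
    cosh u * log (2 * cosh v) + sinh u * (u - v) - cosh u * log (2 * cosh u) ≤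
      k * (cosh (u - v) - 1) := by
  have h := aux_F k v u hk
  have hks : k * sinh v = v := by
    rw [hk]; split_ifs with h0
    · simp [h0]
    · have : sinh v ≠ 0 := by simpa using h0
      field_simp
  have hu := cosh_pos u
  have hv := cosh_pos v
  rw [log_mul two_ne_zero hv.ne', log_mul two_ne_zero hu.ne', cosh_sub]
  have e : v * (sinh v / cosh v) + k / cosh v = k * cosh v := by
    nth_rewrite 1 [← hks]
    have := cosh_sq v
    field_simp
    rw [this]
  have h' : cosh u * (log (cosh v) - k * cosh v) ≤
      cosh u * (log (cosh u) - u * (sinh u / cosh u) - k / cosh u) := by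
    apply mul_le_mul_of_nonneg_left _ hu.le
    linarith
  have e2 : cosh u * (log (cosh u) - u * (sinh u / cosh u) - k / cosh u) =
      cosh u * log (cosh u) - u * sinh u - k := by
    field_simp
  rw [e2] at h'
  have e3 : k * (cosh u * cosh v - sinh u * sinh v - 1) =
    k * cosh u * cosh v - sinh u * v - k := by
    linear_combination (-sinh u) * hks
  rw [e3]
  nlinarith

open Real in
theorem aux_param {a b : ℝ} (ha : 0 < a) (hb : 0 < b) :
    ∃ m u : ℝ, 0 < m ∧ a = m * exp (-u) ∧ b = m * exp u := by
  refine ⟨exp ((log a + log b) / 2), (log b - log a) / 2, exp_pos _, ?_, ?_⟩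
  · rw [← exp_add]; ring_nf; rw [exp_log ha]
  · rw [← exp_add]; ring_nf; rw [exp_log hb]

open Real in
theorem aux_cLS {w v : ℝ} (hw : 0 < w) (h1 : 2 * w * cosh v = 1) :
    cLS (w * exp (-v)) * w = if v = 0 then 1 else v / sinh v := by
  have hq : 1 - w * exp (-v) = w * exp v := by
    rw [← h1, cosh_eq]; ring
  unfold cLS
  have hs : 1 - 2 * (w * exp (-v)) = 2 * w * sinh v := by
    rw [← h1, cosh_eq, sinh_eq]; ring
  have hiff : w * exp (-v) = 1 / 2 ↔ v = 0 := by
    rw [← sinh_eq_zero]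
    constructor
    · intro h
      have : 2 * w * sinh v = 0 := by rw [← hs, h]; norm_num
      simpa [hw.ne'] using this
    · intro h
      rw [h] at hs; linarith
  by_cases hv : v = 0
  · subst hv
    rw [if_pos (hiff.2 rfl), if_pos rfl]
    simpa using h1
  · rw [if_neg (mt hiff.1 hv), if_neg hv, hs, hq, log_mul hw.ne' (exp_pos _).ne',
      log_mul hw.ne' (exp_pos _).ne', log_exp, log_exp]
    have : sinh v ≠ 0 := by simpa using hv
    field_simp
    ring

theorem aux_cLS_nonneg {p : ℝ} (hp : p ∈ Set.Ioo (0 : ℝ) 1) : 0 ≤ cLS p := by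
  have hp0 := hp.1
  have hp1 := hp.2
  unfold cLS
  split_ifs with h
  · norm_num
  · rcases lt_or_gt_of_ne h with h | h
    · have := Real.log_le_log hp0 (show p ≤ 1 - p by linarith)
      exact div_nonneg (by linarith) (by linarith)
    · have := Real.log_le_log (show 0 < 1 - p by linarith) (show 1 - p ≤ p by linarith)
      exact div_nonneg_of_nonpos (by linarith) (by linarith)

open Real in
theorem aux_two_pos {p : ℝ} (hp : p ∈ Set.Ioo (0 : ℝ) 1) {X Y : ℝ} (hX : 0 < X) (hY : 0 < Y) :
    p * (X * log X) + (1 - p) * (Y * log Y) -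
      (p * X + (1 - p) * Y) * log (p * X + (1 - p) * Y) ≤
      cLS p * (p * (1 - p) * (X + Y - 2 * (√X * √Y))) := by
  have hp0 := hp.1
  have hq0 : 0 < 1 - p := by linarith [hp.2]
  obtain ⟨w, v, hw, hpw, hqw⟩ := aux_param hp0 hq0
  obtain ⟨m, s, hm, hXm, hYm⟩ := aux_param hX hY
  have h1 : 2 * w * cosh v = 1 := by
    rw [cosh_eq]; linarith
  have hc := aux_cLS hw h1
  rw [← hpw] at hc
  have core := aux_core (cLS p * w) v (v + s) hc
  have ev := exp_pos v
  have es := exp_pos s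
  have hpX : p * X = w * m * exp (-(v + s)) := by
    rw [hpw, hXm, neg_add, exp_add]; ring
  have hqY : (1 - p) * Y = w * m * exp (v + s) := by
    rw [hqw, hYm, exp_add]; ring
  have hS : p * X + (1 - p) * Y = w * m * (2 * cosh (v + s)) := by
    rw [hpX, hqY, cosh_eq]; ring
  have hsq : √X * √Y = m := by
    rw [← sqrt_mul hX.le, hXm, hYm]
    rw [show m * exp (-s) * (m * exp s) = m ^ 2 * (exp (-s) * exp s) by ring, ← exp_add]
    simp [hm.le]
  have hXY : X + Y = m * (2 * cosh s) := by rw [hXm, hYm, cosh_eq]; ring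
  have hpq : p * (1 - p) = w ^ 2 := by
    rw [hqw, hpw, show w * exp (-v) * (w * exp v) = w ^ 2 * (exp (-v) * exp v) by ring, ← exp_add]
    simp
  have hlX : log X = log m - s := by
    rw [hXm, log_mul hm.ne' (exp_pos _).ne', log_exp]; ring
  have hlY : log Y = log m + s := by
    rw [hYm, log_mul hm.ne' (exp_pos _).ne', log_exp]
  have hlv : log (2 * cosh v) = - log w := by
    rw [← log_inv]; congr 1
    field_simp; linarith
  have hcp := cosh_pos (v + s)
  rw [← mul_assoc p, ← mul_assoc (1 - p), hS, hlX, hlY, hsq, hXY, hpq,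
    log_mul (by positivity) (by positivity), log_mul hw.ne' hm.ne', hpX, hqY]
  have e1 : exp (v + s) = cosh (v + s) + sinh (v + s) := (cosh_add_sinh _).symm
  have e2 : exp (-(v + s)) = cosh (v + s) - sinh (v + s) := (cosh_sub_sinh _).symm
  rw [e1, e2]
  rw [hlv, show v + s - v = s by ring] at core
  have := mul_le_mul_of_nonneg_left core (show 0 ≤ 2 * w * m by positivity)
  nlinarith

open Real in
theorem aux_two {p : ℝ} (hp : p ∈ Set.Ioo (0 : ℝ) 1) {X Y : ℝ} (hX : 0 ≤ X) (hY : 0 ≤ Y) :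
    p * (X * log X) + (1 - p) * (Y * log Y) -
      (p * X + (1 - p) * Y) * log (p * X + (1 - p) * Y) ≤
      cLS p * (p * (1 - p) * (X + Y - 2 * (√X * √Y))) := by
  have hcl : IsClosed {z : ℝ × ℝ | p * (z.1 * log z.1) + (1 - p) * (z.2 * log z.2) -
      (p * z.1 + (1 - p) * z.2) * log (p * z.1 + (1 - p) * z.2) ≤
      cLS p * (p * (1 - p) * (z.1 + z.2 - 2 * (√z.1 * √z.2)))} := by
    have c := continuous_mul_log
    have c1 : Continuous fun z : ℝ × ℝ => z.1 * log z.1 := c.comp continuous_fst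
    have c2 : Continuous fun z : ℝ × ℝ => z.2 * log z.2 := c.comp continuous_snd
    have c3 : Continuous fun z : ℝ × ℝ =>
        (p * z.1 + (1 - p) * z.2) * log (p * z.1 + (1 - p) * z.2) :=
      c.comp (f := fun z : ℝ × ℝ => p * z.1 + (1 - p) * z.2) (by fun_prop)
    exact isClosed_le (by fun_prop) (by fun_prop)
  have hsub : Set.Ioi (0 : ℝ) ×ˢ Set.Ioi (0 : ℝ) ⊆ {z : ℝ × ℝ | p * (z.1 * log z.1) +
      (1 - p) * (z.2 * log z.2) -
      (p * z.1 + (1 - p) * z.2) * log (p * z.1 + (1 - p) * z.2) ≤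
      cLS p * (p * (1 - p) * (z.1 + z.2 - 2 * (√z.1 * √z.2)))} :=
    fun z hz => aux_two_pos hp hz.1 hz.2
  have h := closure_minimal hsub hcl
  rw [closure_prod_eq, closure_Ioi] at h
  exact h (show (X, Y) ∈ Set.Ici (0 : ℝ) ×ˢ Set.Ici (0 : ℝ) from ⟨hX, hY⟩)

theorem muE_succ (n : ℕ) (p : ℝ) (f : (Fin (n + 1) → Bool) → ℝ) :
    muE (n + 1) p f = p * muE n p (fun y => f (Fin.cons true y)) +
      (1 - p) * muE n p (fun y => f (Fin.cons false y)) := by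
  unfold muE
  rw [← (Fin.consEquiv (fun _ : Fin (n + 1) => Bool)).sum_comp, Fintype.sum_prod_type]
  simp [Fin.consEquiv, muW, Fin.prod_univ_succ, Finset.mul_sum, mul_assoc]

theorem muW_nonneg (n : ℕ) {p : ℝ} (hp : p ∈ Set.Ioo (0 : ℝ) 1) (x : Fin n → Bool) :
    0 ≤ muW n p x := by
  unfold muW
  refine Finset.prod_nonneg fun i _ => ?_
  split_ifs
  · exact hp.1.le
  · linarith [hp.2]

theorem muE_nonneg (n : ℕ) {p : ℝ} (hp : p ∈ Set.Ioo (0 : ℝ) 1) (f : (Fin n → Bool) → ℝ)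
    (hf : ∀ x, 0 ≤ f x) : 0 ≤ muE n p f :=
  Finset.sum_nonneg fun x _ => mul_nonneg (muW_nonneg n hp x) (hf x)

theorem muE_cs (n : ℕ) {p : ℝ} (hp : p ∈ Set.Ioo (0 : ℝ) 1) (f g : (Fin n → Bool) → ℝ) :
    muE n p (fun x => f x * g x) ≤
      √(muE n p fun x => f x ^ 2) * √(muE n p fun x => g x ^ 2) := by
  have h := Real.sum_mul_le_sqrt_mul_sqrt Finset.univ
    (fun x => √(muW n p x) * f x) (fun x => √(muW n p x) * g x)
  have hs : ∀ x, √(muW n p x) ^ 2 = muW n p x := fun x => Real.sq_sqrt (muW_nonneg n hp x)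
  unfold muE
  simp only [mul_pow, hs] at h
  refine le_trans (le_of_eq (Finset.sum_congr rfl fun x _ => ?_)) h
  calc _ = √(muW n p x) ^ 2 * (f x * g x) := by rw [hs]
    _ = _ := by ring

theorem muE_sq_sub (n : ℕ) (p : ℝ) (f g : (Fin n → Bool) → ℝ) (c : ℝ) :
    muE n p (fun x => c * (f x - g x) ^ 2) = c * (muE n p (fun x => f x ^ 2) +
      muE n p (fun x => g x ^ 2) - 2 * muE n p (fun x => f x * g x)) := by
  unfold muE
  rw [← Finset.sum_add_distrib, Finset.mul_sum, ← Finset.sum_sub_distrib, Finset.mul_sum]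
  exact Finset.sum_congr rfl fun x _ => by ring

theorem del_zero_cons (n : ℕ) (p : ℝ) (f : (Fin (n + 1) → Bool) → ℝ) (b : Bool)
    (y : Fin n → Bool) :
    del (n + 1) p 0 f (Fin.cons b y) =
      f (Fin.cons b y) - (p * f (Fin.cons true y) + (1 - p) * f (Fin.cons false y)) := by
  simp [del, Fin.update_cons_zero]

theorem del_succ_cons (n : ℕ) (p : ℝ) (f : (Fin (n + 1) → Bool) → ℝ) (b : Bool) (i : Fin n)
    (y : Fin n → Bool) :
    del (n + 1) p i.succ f (Fin.cons b y) = del n p i (fun y => f (Fin.cons b y)) y := by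
  simp [del, ← Fin.cons_update]

theorem aux_main (n : ℕ) (p : ℝ) (hp : p ∈ Set.Ioo (0 : ℝ) 1) (f : (Fin n → Bool) → ℝ) :
    ent n p (fun x => f x ^ 2) ≤
      cLS p * ∑ i : Fin n, muE n p (fun x => del n p i f x ^ 2) := by
  induction n with
  | zero => simp [ent, muE, muW]
  | succ n ih =>
    have i1 := ih fun y => f (Fin.cons true y)
    have i0 := ih fun y => f (Fin.cons false y)
    have hp0 := hp.1
    have hq0 : 0 < 1 - p := by linarith [hp.2]
    have hc := aux_cLS_nonneg hp
    have hX := muE_nonneg n hp (fun y => f (Fin.cons true y) ^ 2) fun x => sq_nonneg _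
    have hY := muE_nonneg n hp (fun y => f (Fin.cons false y) ^ 2) fun x => sq_nonneg _
    have two := aux_two hp hX hY
    have cs := muE_cs n hp (fun y => f (Fin.cons true y)) (fun y => f (Fin.cons false y))
    rw [Fin.sum_univ_succ]
    simp only [ent, muE_succ, del_succ_cons, del_zero_cons, Finset.sum_add_distrib,
      ← Finset.mul_sum] at *
    have e1 : ∀ y : Fin n → Bool, (f (Fin.cons true y) - (p * f (Fin.cons true y) +
        (1 - p) * f (Fin.cons false y))) ^ 2 =
        (1 - p) ^ 2 * (f (Fin.cons true y) - f (Fin.cons false y)) ^ 2 := fun y => by ring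
    have e0 : ∀ y : Fin n → Bool, (f (Fin.cons false y) - (p * f (Fin.cons true y) +
        (1 - p) * f (Fin.cons false y))) ^ 2 =
        p ^ 2 * (f (Fin.cons true y) - f (Fin.cons false y)) ^ 2 := fun y => by ring
    simp only [e1, e0, muE_sq_sub n p (fun y => f (Fin.cons true y))
      (fun y => f (Fin.cons false y))]
    have j1 := mul_le_mul_of_nonneg_left i1 hp0.le
    have j0 := mul_le_mul_of_nonneg_left i0 hq0.le
    have j2 := mul_le_mul_of_nonneg_left cs
      (show 0 ≤ 2 * (cLS p * (p * (1 - p))) by positivity)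
    linarith

/-- logarithmic Sobolev inequality (5):
`Ent_{μ_p}(f²) ≤ c_LS(p) ∑ᵢ ∫ (Δᵢ f)² dμ_p`. -/
theorem stmt10 (n : ℕ) (hn : 0 < n) (p : ℝ) (hp : p ∈ Set.Ioo (0 : ℝ) 1)
    (f : (Fin n → Bool) → ℝ) :
    ent n p (fun x => f x ^ 2) ≤
      cLS p * ∑ i : Fin n, muE n p (fun x => del n p i f x ^ 2) := by
  exact aux_main n p hp f
end
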